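/- Let Z be a planar Brownian motion, K a compact subset of the open upper half-plane ℍ, and S a closed subset of the closed upper half-plane with S ∩ K = ∅ and sup{Im z : z ∈ S} < ∞. Then lim_{ε→0} sup{ P_w(σ_{B(z,ε)} < τ_{closure(ℍ)}) : z ∈ S, w ∈ K } = 0, where σ denotes hitting time and τ denotes exit time. -/

import Mathlib

open MeasureTheory Filter

/-- The complex upper half-plane. -/
def UH : Set ℂ := {z | 0 < z.im}

/-- A planar Brownian motion with sample space `Ω`: a family of probability
measures `P w` (the law of Brownian motion started at `w`), with continuous
paths, Gaussian increments and independent increments. -/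
structure PlanarBM (Ω : Type*) [MeasurableSpace Ω] where
  Z : ℝ → Ω → ℂ
  P : ℂ → Measure Ω
  isProb : ∀ w, IsProbabilityMeasure (P w)
  meas : ∀ t, Measurable (Z t)
  start : ∀ w, ∀ᵐ ω ∂P w, Z 0 ω = w
  contPaths : ∀ w, ∀ᵐ ω ∂P w, Continuous fun t => Z t ω
  incrLaw : ∀ (w : ℂ) (s t : ℝ), 0 ≤ s → s ≤ t →
    (P w).map (fun ω => Z t ω - Z s ω) =
      (((ProbabilityTheory.gaussianReal 0 (Real.toNNReal (t - s))).prod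
        (ProbabilityTheory.gaussianReal 0 (Real.toNNReal (t - s)))).map
        fun p : ℝ × ℝ => Complex.equivRealProd.symm p)
  indepIncr : ∀ (w : ℂ) (s t : ℝ), 0 ≤ s → s ≤ t →
    ProbabilityTheory.IndepFun (fun ω => Z t ω - Z s ω)
      (fun ω => fun u : Set.Iic s => Z u.1 ω) (P w)

/-- First hitting time of the set `A` by the path `f` (∞ if never hit). -/
noncomputable def hitTime (f : ℝ → ℂ) (A : Set ℂ) : ENNReal :=
  sInf (ENNReal.ofReal '' {t : ℝ | 0 ≤ t ∧ f t ∈ A})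

/-- First exit time of the path `f` from the set `D`. -/
noncomputable def exitTime (f : ℝ → ℂ) (D : Set ℂ) : ENNReal :=
  hitTime f Dᶜ

/-- The path `f` exits the domain `D` (in finite time) through the set `B`. -/
def exitsInto (f : ℝ → ℂ) (D B : Set ℂ) : Prop :=
  ∃ t : ℝ, 0 ≤ t ∧ ENNReal.ofReal t = exitTime f D ∧ f t ∈ B

/-- Harmonic measure of `B` in `D` seen from `z`: the probability that Brownian
motion started at `z` exits `D` through `B`. -/
noncomputable def Hm {Ω : Type*} [MeasurableSpace Ω] (BM : PlanarBM Ω)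
    (D B : Set ℂ) (z : ℂ) : ENNReal :=
  BM.P z {ω | exitsInto (fun t => BM.Z t ω) D B}

open ProbabilityTheory
open scoped NNReal ENNReal

/-- The law of a planar Brownian increment over a time span `v`. -/
noncomputable def planarGaussian (v : ℝ≥0) : Measure ℂ :=
  ((gaussianReal 0 v).prod (gaussianReal 0 v)).map
    fun p : ℝ × ℝ => Complex.equivRealProd.symm p

/-- The planar heat kernel at time `r`. -/
noncomputable def heatKernel (r : ℝ≥0) (x : ℂ) : ℝ≥0∞ :=
  gaussianPDF 0 r x.re * gaussianPDF 0 r x.im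

lemma measurable_equivRealProd_symm :
    Measurable fun p : ℝ × ℝ => Complex.equivRealProd.symm p :=
  Complex.measurableEquivRealProd.symm.measurable

lemma measurable_heatKernel (r : ℝ≥0) : Measurable (heatKernel r) :=
  ((measurable_gaussianPDF 0 r).comp Complex.measurable_re).mul
    ((measurable_gaussianPDF 0 r).comp Complex.measurable_im)

instance isProbabilityMeasure_planarGaussian (v : ℝ≥0) :
    IsProbabilityMeasure (planarGaussian v) :=
  Measure.isProbabilityMeasure_map measurable_equivRealProd_symm.aemeasurable

lemma lintegral_gaussianPDF_add {r h : ℝ≥0} (hr : r ≠ 0) (hh : h ≠ 0) (x : ℝ) :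
    ∫⁻ ξ, gaussianPDF 0 r (x + ξ) ∂gaussianReal 0 h = gaussianPDF 0 (r + h) x := by
  have hr' : (0 : ℝ) < r := by positivity
  have hh' : (0 : ℝ) < h := by positivity
  have hv : r * h / (r + h) ≠ 0 := by positivity
  rw [gaussianReal_of_var_ne_zero _ hh,
    lintegral_withDensity_eq_lintegral_mul _ (measurable_gaussianPDF 0 h)
      (g := fun ξ => gaussianPDF 0 r (x + ξ))
      ((measurable_gaussianPDF 0 r).comp (measurable_const_add x))]
  have key : ∀ ξ : ℝ, gaussianPDF 0 h ξ * gaussianPDF 0 r (x + ξ) =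
      gaussianPDF 0 (r + h) x * gaussianPDF (-(x * h / (r + h))) (r * h / (r + h)) ξ := by
    intro ξ
    simp only [gaussianPDF, ← ENNReal.ofReal_mul (gaussianPDFReal_nonneg _ _ _)]
    congr 1
    simp only [gaussianPDFReal]
    rw [mul_mul_mul_comm (√(2 * Real.pi * h))⁻¹,
      mul_mul_mul_comm (√(2 * Real.pi * (r + h : ℝ≥0)))⁻¹,
      ← Real.exp_add, ← Real.exp_add, ← mul_inv, ← mul_inv,
      ← Real.sqrt_mul (by positivity), ← Real.sqrt_mul (by positivity)]
    push_cast
    congr 2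
    · congr 1
      field_simp
    · field_simp
      ring
  simp only [Pi.mul_apply, key]
  rw [lintegral_const_mul _ (measurable_gaussianPDF _ _), lintegral_gaussianPDF_eq_one _ hv,
    mul_one]

lemma lintegral_heatKernel_add {r h : ℝ≥0} (hr : r ≠ 0) (hh : h ≠ 0) (x : ℂ) :
    ∫⁻ ξ, heatKernel r (x + ξ) ∂planarGaussian h = heatKernel (r + h) x := by
  rw [planarGaussian, lintegral_map (f := fun ξ => heatKernel r (x + ξ))
    ((measurable_heatKernel r).comp (measurable_const_add x)) measurable_equivRealProd_symm]
  simp only [heatKernel, Complex.add_re, Complex.add_im, Complex.equivRealProd_symm_apply,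
    Complex.ofReal_re, Complex.ofReal_im, Complex.mul_re, Complex.mul_im, Complex.I_re,
    Complex.I_im, mul_zero, mul_one, sub_zero, add_zero, zero_add]
  rw [lintegral_prod_mul (f := fun a => gaussianPDF 0 r (x.re + a))
    (g := fun b => gaussianPDF 0 r (x.im + b))
    ((measurable_gaussianPDF 0 r).comp (measurable_const_add _)).aemeasurable
    ((measurable_gaussianPDF 0 r).comp (measurable_const_add _)).aemeasurable,
    lintegral_gaussianPDF_add hr hh, lintegral_gaussianPDF_add hr hh]

lemma heatKernel_eq_ofReal (r : ℝ≥0) (x : ℂ) :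
    heatKernel r x = ENNReal.ofReal ((2 * Real.pi * r)⁻¹ * Real.exp (-‖x‖ ^ 2 / (2 * r))) := by
  rw [heatKernel, gaussianPDF, gaussianPDF, ← ENNReal.ofReal_mul (gaussianPDFReal_nonneg _ _ _)]
  congr 1
  simp only [gaussianPDFReal]
  rw [mul_mul_mul_comm, ← mul_inv, ← Real.exp_add, Real.mul_self_sqrt (by positivity),
    ← Complex.normSq_eq_norm_sq, Complex.normSq_apply]
  congr 2
  ring

lemma heatKernel_le {r : ℝ≥0} (hr : r ≠ 0) {x : ℂ} {d : ℝ} (hd : 0 < d) (hx : d ≤ ‖x‖) :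
    heatKernel r x ≤ ENNReal.ofReal (1 / d ^ 2) := by
  have hr' : (0 : ℝ) < r := by positivity
  rw [heatKernel_eq_ofReal]
  apply ENNReal.ofReal_le_ofReal
  have h1 : ‖x‖ ^ 2 / (2 * r) ≤ Real.exp (‖x‖ ^ 2 / (2 * r)) := by
    linarith [Real.add_one_le_exp (‖x‖ ^ 2 / (2 * r))]
  have h2 : d ^ 2 ≤ ‖x‖ ^ 2 := by gcongr
  rw [neg_div, Real.exp_neg, ← mul_inv, ← one_div]
  apply one_div_le_one_div_of_le (by positivity)
  have h3 : ‖x‖ ^ 2 ≤ 2 * r * Real.exp (‖x‖ ^ 2 / (2 * r)) := by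
    rw [div_le_iff₀ (by positivity)] at h1
    linarith
  have h4 : (1 : ℝ) ≤ Real.pi := by linarith [Real.pi_gt_three]
  nlinarith [Real.exp_pos (‖x‖ ^ 2 / (2 * r)),
    mul_pos hr' (Real.exp_pos (‖x‖ ^ 2 / (2 * r)))]

lemma le_heatKernel {r : ℝ≥0} (hr : r ≠ 0) {x : ℂ} (hx : ‖x‖ ^ 2 ≤ r) :
    ENNReal.ofReal ((2 * Real.pi * r)⁻¹ * Real.exp (-1)) ≤ heatKernel r x := by
  have hr' : (0 : ℝ) < r := by positivity
  rw [heatKernel_eq_ofReal]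
  apply ENNReal.ofReal_le_ofReal
  gcongr
  rw [neg_div, neg_le_neg_iff, div_le_one (by positivity)]
  linarith

/-- The Green function of the random walk with planar Gaussian steps of variance `h`, run for
`n` steps, with pole at `z` mollified at scale `a`. -/
noncomputable def walkGreen (a h : ℝ≥0) (z : ℂ) (n : ℕ) (x : ℂ) : ℝ≥0∞ :=
  ∑ j ∈ Finset.range n, heatKernel (a + j * h) (x - z)

lemma measurable_walkGreen (a h : ℝ≥0) (z : ℂ) (n : ℕ) : Measurable (walkGreen a h z n) :=
  Finset.measurable_sum _ fun _ _ => (measurable_heatKernel _).comp (measurable_id.sub_const z)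

lemma lintegral_walkGreen_le {a h : ℝ≥0} (ha : a ≠ 0) (hh : h ≠ 0) (z : ℂ) (n : ℕ) (x : ℂ) :
    ∫⁻ ξ, walkGreen a h z n (x + ξ) ∂planarGaussian h ≤ walkGreen a h z (n + 1) x := by
  have hm : ∀ r, Measurable fun ξ => heatKernel r (x + ξ - z) := fun r =>
    (measurable_heatKernel r).comp ((measurable_const_add x).sub_const z)
  simp only [walkGreen]
  rw [lintegral_finsetSum _ fun _ _ => hm _, Finset.sum_range_succ']
  refine le_add_right (Finset.sum_le_sum fun j _ => le_of_eq ?_)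
  simp only [add_sub_right_comm]
  rw [lintegral_heatKernel_add (by positivity) hh]
  congr 1
  push_cast
  ring

lemma walkGreen_le {a h : ℝ≥0} (ha : a ≠ 0) {z x : ℂ} {d : ℝ} (hd : 0 < d)
    (hx : d ≤ ‖x - z‖) (n : ℕ) : walkGreen a h z n x ≤ n * ENNReal.ofReal (1 / d ^ 2) := by
  refine (Finset.sum_le_card_nsmul _ _ _ fun j _ => heatKernel_le (by positivity) hd hx).trans ?_
  simp

lemma log_le_sum_inv {a h : ℝ} (ha : 0 < a) (hh : 0 < h) (n : ℕ) :
    Real.log ((a + n * h) / a) ≤ ∑ j ∈ Finset.range n, h * (a + j * h)⁻¹ := by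
  induction n with
  | zero => simp [ha.ne']
  | succ n ih =>
    rw [Finset.sum_range_succ]
    have hp : 0 < a + n * h := by positivity
    have e : (a + (n + 1 : ℕ) * h) / a = (a + n * h) / a * (1 + h * (a + n * h)⁻¹) := by
      push_cast
      field_simp
      ring
    rw [e, Real.log_mul (by positivity) (by positivity)]
    have := Real.log_le_sub_one_of_pos (x := 1 + h * (a + n * h)⁻¹) (by positivity)
    linarith

lemma le_walkGreen {a h : ℝ≥0} (ha : a ≠ 0) (hh : h ≠ 0) {z x : ℂ} (hx : ‖x - z‖ ^ 2 ≤ a) {n : ℕ}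
    (hn : 1 ≤ n * h) :
    ENNReal.ofReal ((h : ℝ)⁻¹ * (Real.exp (-1) / (2 * Real.pi) * Real.log ((a + 1) / a))) ≤
      walkGreen a h z n x := by
  have ha' : (0 : ℝ) < a := by positivity
  have hh' : (0 : ℝ) < h := by positivity
  have hn' : (1 : ℝ) ≤ n * h := by exact_mod_cast hn
  have h1 : Real.log ((a + 1) / a) ≤ ∑ j ∈ Finset.range n, (h : ℝ) * (a + j * h : ℝ)⁻¹ := by
    refine le_trans (Real.log_le_log (by positivity) ?_) (log_le_sum_inv ha' hh' n)
    gcongr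
  calc _ ≤ ENNReal.ofReal (∑ j ∈ Finset.range n,
        (2 * Real.pi * (a + j * h : ℝ))⁻¹ * Real.exp (-1)) := by
        apply ENNReal.ofReal_le_ofReal
        calc _ ≤ (h : ℝ)⁻¹ * (Real.exp (-1) / (2 * Real.pi) *
              ∑ j ∈ Finset.range n, (h : ℝ) * (a + j * h : ℝ)⁻¹) := by gcongr
          _ = _ := by
            rw [Finset.mul_sum, Finset.mul_sum]
            refine Finset.sum_congr rfl fun j _ => ?_
            have : (0 : ℝ) < a + j * h := by positivity
            field_simp
    _ = ∑ j ∈ Finset.range n, ENNReal.ofReal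
        ((2 * Real.pi * (a + j * h : ℝ))⁻¹ * Real.exp (-1)) :=
        ENNReal.ofReal_sum_of_nonneg fun j _ => by positivity
    _ ≤ _ := by
        refine Finset.sum_le_sum fun j _ => ?_
        have := le_heatKernel (r := a + j * h) (x := x - z) (by positivity)
          (hx.trans (by push_cast; exact le_add_of_nonneg_right (by positivity)))
        exact_mod_cast this

namespace PlanarBM

variable {Ω : Type*} [MeasurableSpace Ω] (BM : PlanarBM Ω)

/-- The path of the process up to time `s`. -/
def past (s : ℝ) (ω : Ω) : Set.Iic s → ℂ := fun u => BM.Z u.1 ω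

lemma measurable_past (s : ℝ) : Measurable (BM.past s) :=
  measurable_pi_lambda _ fun u => BM.meas u.1

/-- The Markov property at a deterministic time. -/
lemma setLIntegral_past_preimage (w : ℂ) {s t : ℝ} (hs : 0 ≤ s) (hst : s ≤ t)
    {A : Set (Set.Iic s → ℂ)} (hA : MeasurableSet A) {f : ℂ → ℝ≥0∞} (hf : Measurable f) :
    ∫⁻ ω in BM.past s ⁻¹' A, f (BM.Z t ω) ∂BM.P w =
      ∫⁻ ω in BM.past s ⁻¹' A,
        ∫⁻ ξ, f (BM.Z s ω + ξ) ∂planarGaussian (t - s).toNNReal ∂BM.P w := by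
  have := BM.isProb w
  have hincr : Measurable fun ω => BM.Z t ω - BM.Z s ω := (BM.meas t).sub (BM.meas s)
  have hpast := BM.measurable_past s
  let e : (Set.Iic s → ℂ) → ℂ := fun x => x ⟨s, Set.mem_Iic.2 le_rfl⟩
  have he : Measurable e := measurable_pi_apply _
  let F : ℂ × (Set.Iic s → ℂ) → ℝ≥0∞ :=
    (Prod.snd ⁻¹' A).indicator fun p => f (e p.2 + p.1)
  have hF : Measurable F :=
    (hf.comp ((he.comp measurable_snd).add measurable_fst)).indicator (measurable_snd hA)
  have hprod : (BM.P w).map (fun ω => (BM.Z t ω - BM.Z s ω, BM.past s ω)) =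
      (planarGaussian (t - s).toNNReal).prod ((BM.P w).map (BM.past s)) := by
    rw [planarGaussian, ← BM.incrLaw w s t hs hst]
    exact (indepFun_iff_map_prod_eq_prod_map_map hincr.aemeasurable hpast.aemeasurable).1
      (BM.indepIncr w s t hs hst)
  have : IsProbabilityMeasure ((BM.P w).map (BM.past s)) :=
    Measure.isProbabilityMeasure_map hpast.aemeasurable
  calc _ = ∫⁻ ω, F (BM.Z t ω - BM.Z s ω, BM.past s ω) ∂BM.P w := by
        rw [← lintegral_indicator (hpast hA)]
        refine lintegral_congr fun ω => ?_
        by_cases h : BM.past s ω ∈ A <;> simp [F, Set.indicator, h, e, past]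
    _ = ∫⁻ p, F p ∂(planarGaussian (t - s).toNNReal).prod ((BM.P w).map (BM.past s)) := by
        rw [← hprod, lintegral_map hF (hincr.prodMk hpast)]
    _ = ∫⁻ x, ∫⁻ ξ, F (ξ, x) ∂planarGaussian (t - s).toNNReal ∂(BM.P w).map (BM.past s) :=
        lintegral_prod_symm _ hF.aemeasurable
    _ = ∫⁻ ω, ∫⁻ ξ, F (ξ, BM.past s ω) ∂planarGaussian (t - s).toNNReal ∂BM.P w :=
        lintegral_map hF.lintegral_prod_left' hpast
    _ = _ := by
        rw [← lintegral_indicator (hpast hA)]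
        refine lintegral_congr fun ω => ?_
        by_cases h : BM.past s ω ∈ A <;> simp [F, Set.indicator, h, e, past]

/-- The maximal inequality for nonnegative space-time supermartingales along a grid of times. -/
lemma mul_measure_exists_grid_mem_le (w : ℂ) (h : ℝ≥0) {B : Set ℂ} (hB : MeasurableSet B)
    {V : ℕ → ℂ → ℝ≥0∞} (hV : ∀ k, Measurable (V k)) {N : ℕ}
    (hsuper : ∀ k < N, ∀ x, ∫⁻ ξ, V (k + 1) (x + ξ) ∂planarGaussian h ≤ V k x)
    {m : ℝ≥0∞} (hm : ∀ k < N, ∀ x ∈ B, m ≤ V k x) :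
    m * BM.P w {ω | ∃ k < N, BM.Z (k * h) ω ∈ B} ≤ V 0 w := by
  let H : ℕ → Set Ω := fun n => {ω | ∃ k < n, BM.Z (k * h) ω ∈ B}
  have hH : ∀ n, MeasurableSet (H n) := by
    intro n
    have : H n = ⋃ k, ⋃ _ : k < n, BM.Z (k * h) ⁻¹' B := by
      ext ω
      simp [H]
    rw [this]
    exact .iUnion fun k => .iUnion fun _ => BM.meas _ hB
  suffices key : ∀ n ≤ N,
      m * BM.P w (H n) + ∫⁻ ω in (H n)ᶜ, V n (BM.Z (n * h) ω) ∂BM.P w ≤ V 0 w from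
    le_self_add.trans (key N le_rfl)
  intro n
  induction n with
  | zero =>
    intro _
    have := BM.isProb w
    have h0 : H 0 = ∅ := by simp [H]
    have h1 : ∀ᵐ ω ∂BM.P w, V 0 (BM.Z ((0 : ℕ) * h) ω) = V 0 w := by
      filter_upwards [BM.start w] with ω hω
      simp [hω]
    rw [h0, Set.compl_empty, Measure.restrict_univ, lintegral_congr_ae h1]
    simp
  | succ n ih =>
    intro hn
    refine le_trans ?_ (ih (by lia))
    let D : Set Ω := BM.Z (n * h) ⁻¹' B
    have hD : MeasurableSet D := BM.meas _ hB
    have hsplit : H (n + 1) = H n ∪ (H n)ᶜ ∩ D := by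
      rw [Set.union_inter_distrib_left, Set.union_compl_self, Set.univ_inter]
      ext ω
      simp only [H, D, Set.mem_ofPred_eq, Set.mem_union, Set.mem_preimage]
      constructor
      · rintro ⟨k, hk, hkB⟩
        rcases Nat.lt_succ_iff_lt_or_eq.1 hk with hk | rfl
        exacts [.inl ⟨k, hk, hkB⟩, .inr hkB]
      · rintro (⟨k, hk, hkB⟩ | hB)
        exacts [⟨k, by lia, hkB⟩, ⟨n, by lia, hB⟩]
    have hcompl : (H (n + 1))ᶜ = (H n)ᶜ \ D := by
      rw [hsplit, Set.compl_union, Set.compl_inter, compl_compl, Set.inter_union_distrib_left]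
      simp [Set.sdiff_eq]
    let A : Set (Set.Iic ((n : ℝ) * h) → ℂ) :=
      {x | ∀ j : Fin (n + 1), x ⟨j * h, by
        have : (j : ℝ) ≤ n := by exact_mod_cast Nat.lt_succ_iff.1 j.2
        exact mul_le_mul_of_nonneg_right this h.2⟩ ∉ B}
    have hA : MeasurableSet A := by
      simp only [A, Set.ofPred_forall]
      have heval : ∀ u, Measurable fun x : Set.Iic ((n : ℝ) * h) → ℂ => x u := measurable_pi_apply
      exact .iInter fun j => (heval _ hB).compl
    have hpast : (H (n + 1))ᶜ = BM.past (n * h) ⁻¹' A := by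
      ext ω
      simp only [H, A, past, Set.mem_compl_iff, Set.mem_ofPred_eq, Set.mem_preimage, not_exists,
        not_and]
      exact ⟨fun hω j => hω j j.2, fun hω k hk => hω ⟨k, hk⟩⟩
    have hstep : ∫⁻ ω in (H (n + 1))ᶜ, V (n + 1) (BM.Z ((n + 1 : ℕ) * h) ω) ∂BM.P w ≤
        ∫⁻ ω in (H n)ᶜ \ D, V n (BM.Z (n * h) ω) ∂BM.P w := by
      have e : (((n + 1 : ℕ) : ℝ) * h - n * h).toNNReal = h := by
        push_cast
        rw [add_mul, one_mul, add_sub_cancel_left, Real.toNNReal_coe]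
      rw [← hcompl, hpast, BM.setLIntegral_past_preimage w (by positivity)
        (by push_cast; nlinarith [h.2]) hA (hV _), e]
      exact lintegral_mono fun ω => hsuper n (by lia) _
    have hhit : m * BM.P w ((H n)ᶜ ∩ D) ≤
        ∫⁻ ω in (H n)ᶜ ∩ D, V n (BM.Z (n * h) ω) ∂BM.P w := by
      rw [← setLIntegral_const]
      exact setLIntegral_mono' ((hH n).compl.inter hD) fun ω hω => hm n (by lia) _ hω.2
    calc _ ≤ m * (BM.P w (H n) + BM.P w ((H n)ᶜ ∩ D)) +
          ∫⁻ ω in (H n)ᶜ \ D, V n (BM.Z (n * h) ω) ∂BM.P w := by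
          gcongr
          rw [hsplit]
          exact measure_union_le _ _
      _ ≤ m * BM.P w (H n) + (∫⁻ ω in (H n)ᶜ ∩ D, V n (BM.Z (n * h) ω) ∂BM.P w +
          ∫⁻ ω in (H n)ᶜ \ D, V n (BM.Z (n * h) ω) ∂BM.P w) := by
          rw [mul_add, add_assoc]
          gcongr
      _ = _ := by rw [lintegral_inter_add_sdiff _ _ hD]

lemma mul_measure_exists_grid_mem_ball_le {z w : ℂ} {ε d : ℝ} (hε : 0 < ε) (hd : 0 < d)
    (hzw : d ≤ ‖w - z‖) (T : ℕ) {q : ℕ} (hq : q ≠ 0) :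
    ENNReal.ofReal (Real.exp (-1) / (2 * Real.pi) * Real.log ((ε ^ 2 + 1) / ε ^ 2)) *
        BM.P w {ω | ∃ k < T * q, BM.Z (k / q) ω ∈ Metric.ball z ε} ≤
      (T + 1) * ENNReal.ofReal (1 / d ^ 2) := by
  let a : ℝ≥0 := ⟨ε ^ 2, by positivity⟩
  have ha : a ≠ 0 := fun h =>
    (by positivity : ε ^ 2 ≠ 0) (congrArg NNReal.toReal h)
  let h : ℝ≥0 := (q : ℝ≥0)⁻¹
  have hh : h ≠ 0 := by positivity
  have hgrid := BM.mul_measure_exists_grid_mem_le w h (Metric.isOpen_ball (x := z)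
    (ε := ε)).measurableSet (V := fun k => walkGreen a h z (T * q + q - k))
    (fun k => measurable_walkGreen a h z _) (N := T * q)
    (fun k hk x => by
      have e : T * q + q - k = T * q + q - (k + 1) + 1 := by lia
      rw [e]
      exact lintegral_walkGreen_le ha hh z _ x)
    (fun k hk x hx => le_walkGreen ha hh (x := x)
      (show ‖x - z‖ ^ 2 ≤ ε ^ 2 by
        rw [mem_ball_iff_norm] at hx
        gcongr)
      (by
        have : (q : ℝ≥0) ≤ (T * q + q - k : ℕ) := by exact_mod_cast (by lia)
        calc (1 : ℝ≥0) = q * h := (mul_inv_cancel₀ (by positivity)).symm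
          _ ≤ _ := by gcongr))
  replace hgrid := hgrid.trans (walkGreen_le ha hd hzw _)
  have e1 : ((h : ℝ))⁻¹ = q := by simp [h]
  have e2 : (((T * q + q - 0 : ℕ)) : ℝ≥0∞) = q * (T + 1) := by
    push_cast
    simp
    ring
  have e3 : ∀ k : ℕ, (k : ℝ) * h = k / q := fun k => by simp [h, div_eq_mul_inv]
  simp only [e1, e3] at hgrid
  rw [e2, ENNReal.ofReal_mul (by positivity), ENNReal.ofReal_natCast, mul_assoc, mul_assoc] at hgrid
  exact (ENNReal.mul_le_mul_iff_right (by exact_mod_cast hq) (by simp)).1 hgrid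

lemma mul_measure_exists_mem_ball_le {z w : ℂ} {ε d : ℝ} (hε : 0 < ε) (hd : 0 < d)
    (hzw : d ≤ ‖w - z‖) (T : ℕ) :
    ENNReal.ofReal (Real.exp (-1) / (2 * Real.pi) * Real.log ((ε ^ 2 + 1) / ε ^ 2)) *
        BM.P w {ω | ∃ t : ℝ, 0 ≤ t ∧ t < T ∧ BM.Z t ω ∈ Metric.ball z ε} ≤
      (T + 1) * ENNReal.ofReal (1 / d ^ 2) := by
  let E : ℕ → Set Ω := fun q => {ω | ∃ k < T * q, BM.Z (k / q) ω ∈ Metric.ball z ε}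
  have hsub : BM.P w {ω | ∃ t : ℝ, 0 ≤ t ∧ t < T ∧ BM.Z t ω ∈ Metric.ball z ε} ≤
      BM.P w (⋃ n, ⋂ q ≥ n, E q) := by
    refine measure_mono_ae ?_
    filter_upwards [BM.contPaths w] with ω hω ⟨t, ht0, htT, ht⟩
    have hfloor : Tendsto (fun q : ℕ => (⌊t * (q : ℝ)⌋₊ : ℝ) / (q : ℝ)) atTop (nhds t) := by
      have hR := tendsto_nat_floor_mul_div_atTop (R := ℝ) ht0
      exact hR.comp tendsto_natCast_atTop_atTop
    have hball := ((hω.tendsto t).comp hfloor).eventually (Metric.isOpen_ball.mem_nhds ht)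
    obtain ⟨n, hn⟩ := eventually_atTop.1 (hball.and (eventually_gt_atTop (0 : ℕ)))
    refine Set.mem_iUnion.2 ⟨n, Set.mem_iInter₂.2 fun q hq => ⟨⌊t * q⌋₊, ?_, (hn q hq).1⟩⟩
    have hq0 : (0 : ℝ) < q := by exact_mod_cast (hn q hq).2
    rw [Nat.floor_lt (by positivity)]
    push_cast
    gcongr
  have hmono : Monotone fun n => ⋂ q ≥ n, E q := fun m n hmn =>
    Set.biInter_subset_biInter_left fun q (hq : n ≤ q) => hmn.trans hq
  refine (mul_le_mul_right hsub _).trans ?_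
  rw [hmono.measure_iUnion, ENNReal.mul_iSup]
  refine iSup_le fun n => le_trans (mul_le_mul_right (measure_mono (t := E (n + 1)) ?_) _)
    (BM.mul_measure_exists_grid_mem_ball_le hε hd hzw T n.succ_ne_zero)
  exact Set.biInter_subset_of_mem (Nat.le_succ n)

lemma _root_.planarGaussian_im_preimage (v : ℝ≥0) {s : Set ℝ} (hs : MeasurableSet s) :
    planarGaussian v (Complex.im ⁻¹' s) = gaussianReal 0 v s := by
  rw [planarGaussian, Measure.map_apply measurable_equivRealProd_symm (Complex.measurable_im hs)]
  have : (fun p : ℝ × ℝ => Complex.equivRealProd.symm p) ⁻¹' (Complex.im ⁻¹' s) =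
      Set.univ ×ˢ s := by
    ext p
    simp
  rw [this, Measure.prod_prod, measure_univ, one_mul]

lemma _root_.gaussianReal_sq_Iio_neg {L : ℝ} (hL : 0 < L) :
    gaussianReal 0 (L ^ 2).toNNReal (Set.Iio (-L)) = gaussianReal 0 1 (Set.Iio (-1)) := by
  have hmap := gaussianReal_map_const_mul (μ := 0) (v := 1) L
  have hv : NNReal.mk (L ^ 2) (sq_nonneg L) * 1 = (L ^ 2).toNNReal := by
    rw [mul_one]
    exact (Real.toNNReal_of_nonneg (sq_nonneg L)).symm
  rw [hv, mul_zero] at hmap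
  rw [← hmap, Measure.map_apply (measurable_const_mul L) measurableSet_Iio]
  congr 1
  ext x
  simp only [Set.mem_preimage, Set.mem_Iio]
  constructor <;> intro h <;> nlinarith

lemma exists_measure_lt_im_le (M T : ℝ) (hT : 0 ≤ T) {δ : ℝ≥0∞} (hδ : δ ≠ 0) :
    ∃ L > 0, ∀ w : ℂ, w.im ≤ M → BM.P w {ω | L < (BM.Z T ω).im} ≤ δ := by
  have htail : Tendsto (gaussianReal 0 (T - 0).toNNReal ∘ fun n : ℕ => Set.Ioi (n : ℝ)) atTop
      (nhds (gaussianReal 0 (T - 0).toNNReal (⋂ n : ℕ, Set.Ioi (n : ℝ)))) :=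
    tendsto_measure_iInter_atTop (fun n => measurableSet_Ioi.nullMeasurableSet)
      (fun m n hmn => Set.Ioi_subset_Ioi (by exact_mod_cast hmn)) ⟨0, measure_ne_top _ _⟩
  have hempty : ⋂ n : ℕ, Set.Ioi (n : ℝ) = ∅ := by
    refine Set.eq_empty_of_forall_notMem fun x hx => ?_
    obtain ⟨n, hn⟩ := exists_nat_ge x
    exact (Set.mem_iInter.1 hx n).not_ge hn
  rw [hempty, measure_empty] at htail
  obtain ⟨n, hn⟩ := (htail.eventually_le_const (pos_iff_ne_zero.2 hδ)).exists
  refine ⟨n + |M| + 1, by positivity, fun w hw => le_trans ?_ hn⟩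
  have hincr : Measurable fun ω => BM.Z T ω - BM.Z 0 ω := (BM.meas T).sub (BM.meas 0)
  calc _ ≤ BM.P w ((fun ω => BM.Z T ω - BM.Z 0 ω) ⁻¹' (Complex.im ⁻¹' Set.Ioi (n : ℝ))) := by
        refine measure_mono_ae ?_
        filter_upwards [BM.start w] with ω hω (h : _ < _)
        change (n : ℝ) < (BM.Z T ω - BM.Z 0 ω).im
        rw [hω, Complex.sub_im]
        linarith [le_abs_self M]
    _ = _ := by
        rw [← Measure.map_apply hincr (Complex.measurable_im measurableSet_Ioi),
          BM.incrLaw w 0 T le_rfl hT]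
        exact planarGaussian_im_preimage _ measurableSet_Ioi

/-- Planar Brownian motion stays in the closed upper half-plane for a long time with small
probability, uniformly over starting points of bounded height. -/
lemma exists_measure_forall_im_nonneg_le (M : ℝ) {δ : ℝ≥0∞} (hδ : δ ≠ 0) :
    ∃ T : ℝ, ∀ w : ℂ, w.im ≤ M →
      BM.P w {ω | ∀ t, 0 ≤ t → t ≤ T → 0 ≤ (BM.Z t ω).im} ≤ δ := by
  set p : ℝ≥0∞ := gaussianReal 0 1 (Set.Iio (-1))
  have hp0 : p ≠ 0 := fun h => by
    have := gaussianReal_absolutelyContinuous' 0 one_ne_zero h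
    simp at this
  have hp1 : p ≤ 1 := prob_le_one
  have hptop : p ≠ ⊤ := ne_top_of_le_ne_top ENNReal.one_ne_top hp1
  set c : ℝ≥0∞ := p / 2 + (1 - p) with hc
  have hc0 : c ≠ 0 := fun h => by simp [hc, hp0] at h
  have hc1 : c < 1 := by
    calc c < p + (1 - p) := by
          rw [hc]
          exact ENNReal.add_lt_add_right (by simp) (ENNReal.half_lt_self hp0 hptop)
      _ = 1 := add_tsub_cancel_of_le hp1
  have key : ∀ n : ℕ, ∃ T : ℝ, 0 ≤ T ∧ ∃ A : Set (Set.Iic T → ℂ), MeasurableSet A ∧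
      (∀ ω, (∀ t, 0 ≤ t → t ≤ T → 0 ≤ (BM.Z t ω).im) → BM.past T ω ∈ A) ∧
      ∀ w : ℂ, w.im ≤ M → BM.P w (BM.past T ⁻¹' A) ≤ c ^ n := by
    intro n
    induction n with
    | zero =>
      refine ⟨0, le_rfl, Set.univ, .univ, fun _ _ => trivial, fun w _ => ?_⟩
      have := BM.isProb w
      simp
    | succ n ih =>
      obtain ⟨T, hT, A, hA, hpath, hbound⟩ := ih
      obtain ⟨L, hL, hLbound⟩ := BM.exists_measure_lt_im_le M T hT
        (δ := c ^ n * (p / 2)) (by simp [hc0, hp0])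
      have hTT : T ≤ T + L ^ 2 := by nlinarith
      let A' : Set (Set.Iic (T + L ^ 2) → ℂ) :=
        {x | (fun u : Set.Iic T => x ⟨u.1, Set.mem_Iic.2 (le_trans u.2 hTT)⟩) ∈ A ∧
          0 ≤ (x ⟨T + L ^ 2, Set.mem_Iic.2 le_rfl⟩).im}
      have hA' : MeasurableSet A' :=
        (measurable_pi_lambda _ (fun u => measurable_pi_apply _) hA).inter
          (measurableSet_le measurable_const (Complex.measurable_im.comp (measurable_pi_apply _)))
      refine ⟨T + L ^ 2, by positivity, A', hA', fun ω hω => ⟨?_, ?_⟩, fun w hw => ?_⟩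
      · exact hpath ω fun t ht htT => hω t ht (htT.trans hTT)
      · exact hω _ (by positivity) le_rfl
      · have := BM.isProb w
        have hincr : Measurable fun ω => BM.Z (T + L ^ 2) ω - BM.Z T ω :=
          (BM.meas _).sub (BM.meas T)
        have hI : MeasurableSet (Complex.im ⁻¹' Set.Ici (-L)) :=
          Complex.measurable_im measurableSet_Ici
        have hlaw : BM.P w ((fun ω => BM.Z (T + L ^ 2) ω - BM.Z T ω) ⁻¹'
            (Complex.im ⁻¹' Set.Ici (-L))) = 1 - p := by
          rw [← Measure.map_apply hincr hI, BM.incrLaw w T _ hT hTT]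
          refine (planarGaussian_im_preimage _ measurableSet_Ici).trans ?_
          rw [add_sub_cancel_left, ← Set.compl_Iio, prob_compl_eq_one_sub measurableSet_Iio,
            gaussianReal_sq_Iio_neg hL]
        calc _ ≤ BM.P w ({ω | L < (BM.Z T ω).im} ∪
              (fun ω => BM.Z (T + L ^ 2) ω - BM.Z T ω) ⁻¹' (Complex.im ⁻¹' Set.Ici (-L)) ∩
                BM.past T ⁻¹' A) := by
              refine measure_mono fun ω hω => ?_
              by_cases h : L < (BM.Z T ω).im
              · exact .inl h
              · refine .inr ⟨?_, hω.1⟩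
                have h2 : 0 ≤ (BM.Z (T + L ^ 2) ω).im := hω.2
                change -L ≤ (BM.Z (T + L ^ 2) ω - BM.Z T ω).im
                rw [Complex.sub_im]
                linarith
          _ ≤ c ^ n * (p / 2) + (1 - p) * c ^ n := by
              refine (measure_union_le _ _).trans (add_le_add (hLbound w hw) ?_)
              have hind : IndepFun (fun ω => BM.Z (T + L ^ 2) ω - BM.Z T ω) (BM.past T)
                (BM.P w) := BM.indepIncr w T _ hT hTT
              rw [hind.measure_inter_preimage_eq_mul _ _ hI hA, hlaw]
              gcongr
              exact hbound w hw
          _ = c ^ (n + 1) := by rw [pow_succ, hc]; ring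
  obtain ⟨n, hn⟩ := ((ENNReal.tendsto_pow_atTop_nhds_zero_of_lt_one hc1).eventually_le_const
    (pos_iff_ne_zero.2 hδ)).exists
  obtain ⟨T, -, A, -, hpath, hbound⟩ := key n
  exact ⟨T, fun w hw => (measure_mono fun ω hω => hpath ω hω).trans ((hbound w hw).trans hn)⟩

end PlanarBM

lemma closure_UH : closure UH = {z : ℂ | 0 ≤ z.im} :=
  Complex.closure_setOfPred_lt_im 0

lemma hitTime_le {f : ℝ → ℂ} {A : Set ℂ} {t : ℝ} (ht : 0 ≤ t) (hA : f t ∈ A) :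
    hitTime f A ≤ ENNReal.ofReal t :=
  sInf_le ⟨t, ⟨ht, hA⟩, rfl⟩

lemma exists_mem_of_hitTime_lt {f : ℝ → ℂ} {A : Set ℂ} {T : ℝ≥0∞} (h : hitTime f A < T) :
    ∃ t, 0 ≤ t ∧ ENNReal.ofReal t < T ∧ f t ∈ A := by
  obtain ⟨_, ⟨t, ⟨ht, hA⟩, rfl⟩, hlt⟩ := sInf_lt_iff.1 h
  exact ⟨t, ht, hlt, hA⟩

lemma forall_im_nonneg_or_exists_mem {f : ℝ → ℂ} {A : Set ℂ}
    (h : hitTime f A < exitTime f (closure UH)) (T : ℝ) :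
    (∀ t, 0 ≤ t → t ≤ T → 0 ≤ (f t).im) ∨ ∃ t, 0 ≤ t ∧ t < T ∧ f t ∈ A := by
  refine or_iff_not_imp_left.2 fun hexit => ?_
  push Not at hexit
  obtain ⟨s, hs, hsT, him⟩ := hexit
  have hle : exitTime f (closure UH) ≤ ENNReal.ofReal s :=
    hitTime_le hs (by simpa [closure_UH] using him)
  obtain ⟨t, ht, hlt, hA⟩ := exists_mem_of_hitTime_lt (h.trans_le hle)
  exact ⟨t, ht, (ENNReal.ofReal_lt_ofReal_iff_of_nonneg ht).1 hlt |>.trans_le hsT, hA⟩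

lemma tendsto_ofReal_log_nhdsGT_zero {c : ℝ} (hc : 0 < c) :
    Tendsto (fun ε : ℝ => ENNReal.ofReal (c * Real.log ((ε ^ 2 + 1) / ε ^ 2)))
      (nhdsWithin 0 (Set.Ioi 0)) (nhds ⊤) := by
  refine ENNReal.tendsto_ofReal_atTop.comp (Tendsto.const_mul_atTop hc
    (Real.tendsto_log_atTop.comp ?_))
  have h := ((tendsto_pow_atTop two_ne_zero).comp (tendsto_inv_nhdsGT_zero (𝕜 := ℝ)))
  refine tendsto_atTop_mono' _ ?_ h
  filter_upwards [self_mem_nhdsWithin] with ε (hε : 0 < ε)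
  simp only [Function.comp_apply]
  rw [inv_pow, ← one_div]
  gcongr
  nlinarith

/-- Uniformly over starting points in a compact set `K` in ℍ disjoint from a
closed set `S ⊆ closure ℍ` with bounded imaginary part, Brownian motion is
unlikely to reach an ε-disk around a point of `S` before leaving `closure ℍ`,
as ε → 0. -/
theorem sup_hit_small_ball_tendsto_zero {Ω : Type*} [MeasurableSpace Ω]
    (BM : PlanarBM Ω) (S K : Set ℂ)
    (hS : IsClosed S) (hSU : S ⊆ closure UH)
    (hK : IsCompact K) (hKU : K ⊆ UH)
    (hdisj : S ∩ K = ∅) (hIm : BddAbove (Complex.im '' S)) :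
    Tendsto
      (fun ε : ℝ => ⨆ z ∈ S, ⨆ w ∈ K,
        BM.P w {ω | hitTime (fun t => BM.Z t ω) (Metric.ball z ε) <
          exitTime (fun t => BM.Z t ω) (closure UH)})
      (nhdsWithin 0 (Set.Ioi 0)) (nhds 0) := by
  have hd : ∃ d > 0, ∀ z ∈ S, ∀ w ∈ K, d ≤ ‖w - z‖ := by
    obtain ⟨d, hd, hdisj'⟩ :=
      (Set.disjoint_iff_inter_eq_empty.2 hdisj).symm.exists_thickenings hK hS
    refine ⟨d, hd, fun z hz w hw => not_lt.1 fun hlt => ?_⟩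
    refine Set.disjoint_left.1 hdisj' (Metric.mem_thickening_iff.2 ⟨w, hw, ?_⟩)
      (Metric.self_subset_thickening hd S hz)
    rwa [dist_comm, dist_eq_norm]
  obtain ⟨d, hd, hdist⟩ := hd
  obtain ⟨M, hM⟩ := (hK.image Complex.continuous_im).bddAbove
  rw [ENNReal.tendsto_nhds_zero]
  intro η hη
  have hη2 : η / 2 ≠ 0 := by simpa using hη.ne'
  obtain ⟨T₀, hT₀⟩ := BM.exists_measure_forall_im_nonneg_le M hη2
  obtain ⟨T, hT⟩ := exists_nat_ge T₀
  have hC : ((T : ℝ≥0∞) + 1) * ENNReal.ofReal (1 / d ^ 2) ≠ ⊤ :=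
    ENNReal.mul_ne_top (by simp) (by simp)
  have hlog := tendsto_ofReal_log_nhdsGT_zero
    (c := Real.exp (-1) / (2 * Real.pi)) (by positivity)
  have hratio := ENNReal.Tendsto.const_div hlog (.inr hC)
  rw [ENNReal.div_top] at hratio
  filter_upwards [hratio.eventually_le_const (pos_iff_ne_zero.2 hη2),
    hlog.eventually (lt_mem_nhds ENNReal.zero_lt_top), self_mem_nhdsWithin] with ε hε hpos hε0
  refine iSup₂_le fun z hz => iSup₂_le fun w hw => ?_
  calc _ ≤ BM.P w ({ω | ∀ t, 0 ≤ t → t ≤ T₀ → 0 ≤ (BM.Z t ω).im} ∪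
        {ω | ∃ t : ℝ, 0 ≤ t ∧ t < T ∧ BM.Z t ω ∈ Metric.ball z ε}) := by
        refine measure_mono fun ω hω => ?_
        rcases forall_im_nonneg_or_exists_mem hω T with h | h
        exacts [.inl fun t ht htT => h t ht (htT.trans hT), .inr h]
    _ ≤ η / 2 + η / 2 := by
        refine (measure_union_le _ _).trans
          (add_le_add (hT₀ w (hM (Set.mem_image_of_mem _ hw))) (le_trans ?_ hε))
        rw [ENNReal.le_div_iff_mul_le (.inl hpos.ne') (.inl ENNReal.ofReal_ne_top), mul_comm]
        exact BM.mul_measure_exists_mem_ball_le hε0 hd (hdist z hz w hw) T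
    _ = η := ENNReal.add_halves η
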